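/- Let G be a finite connected simple graph containing exactly one cycle, and suppose that this cycle has length 5 and contains a vertex whose degree in G is 2. Then the edge ideal I(G) is bridge-friendly. -/

import Mathlib

/-- The "lcm" of a collection of supports of squarefree monomials: the union. -/
def lcmU {α : Type*} [DecidableEq α] (σ : Finset (Finset α)) : Finset α := σ.sup id

/-- `m` is a bridge of `σ`: `m ∈ σ` and removing `m` does not change the lcm. -/
def IsBridge {α : Type*} [DecidableEq α] (σ : Finset (Finset α)) (m : Finset α) : Prop :=
  m ∈ σ ∧ lcmU (σ.erase m) = lcmU σ

/-- `m` is a gap of `σ` (relative to the generating set `M`): `m ∈ M`, `m ∉ σ`,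
and adding `m` does not change the lcm. -/
def IsGap {α : Type*} [DecidableEq α] (M : Set (Finset α)) (σ : Finset (Finset α))
    (m : Finset α) : Prop :=
  m ∈ M ∧ m ∉ σ ∧ lcmU (insert m σ) = lcmU σ

/-- `m` is a true gap of `σ` w.r.t. the total order encoded by `ord`
(`a` dominates `b` iff `ord b < ord a`). -/
def IsTrueGap {α : Type*} [DecidableEq α] (M : Set (Finset α)) (ord : Finset α → ℕ)
    (σ : Finset (Finset α)) (m : Finset α) : Prop :=
  IsGap M σ m ∧ ∀ m', IsBridge (insert m σ) m' → ord m' < ord m → IsBridge σ m'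

/-- `σ` is potentially-type-2: it has a bridge dominating no true gap of `σ`. -/
def PotType2 {α : Type*} [DecidableEq α] (M : Set (Finset α)) (ord : Finset α → ℕ)
    (σ : Finset (Finset α)) : Prop :=
  ∃ m, IsBridge σ m ∧ ∀ g, IsTrueGap M ord σ g → ¬ ord g < ord m

/-- `b` is the smallest bridge of `σ` w.r.t. the total order encoded by `ord`. -/
def IsSBridge {α : Type*} [DecidableEq α] (ord : Finset α → ℕ) (σ : Finset (Finset α))
    (b : Finset α) : Prop :=
  IsBridge σ b ∧ ∀ b', IsBridge σ b' → ord b ≤ ord b'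

/-- `σ` is type-2: it is potentially-type-2, and any other potentially-type-2 `σ'` with
`σ' \ {sbridge σ'} = σ \ {sbridge σ}` satisfies `sbridge σ' ≻ sbridge σ`. -/
def Type2 {α : Type*} [DecidableEq α] (M : Set (Finset α)) (ord : Finset α → ℕ)
    (σ : Finset (Finset α)) : Prop :=
  PotType2 M ord σ ∧ ∀ σ' : Finset (Finset α), ↑σ' ⊆ M → σ' ≠ σ → PotType2 M ord σ' →
    ∀ b b', IsSBridge ord σ b → IsSBridge ord σ' b' → σ'.erase b' = σ.erase b →
      ord b < ord b'

/-- `M` (an antichain of supports of the minimal generators of a squarefree monomial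
ideal) is bridge-friendly: there is a total order on `M` (encoded by an injection
`ord : Finset α → ℕ`, where `a ≻ b` iff `ord b < ord a`) for which every
potentially-type-2 subset of `M` is type-2. -/
def BridgeFriendly {α : Type*} [DecidableEq α] (M : Set (Finset α)) : Prop :=
  ∃ ord : Finset α → ℕ, Set.InjOn ord M ∧
    ∀ σ : Finset (Finset α), ↑σ ⊆ M → PotType2 M ord σ → Type2 M ord σ

/-- The set of edges of a simple graph `G`, each edge recorded as a 2-element
`Finset` of vertices; this is the set of supports of the minimal generators of the
edge ideal `I(G)`. -/
def edgeSets {V : Type*} [DecidableEq V] (G : SimpleGraph V) : Set (Finset V) :=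
  {s | ∃ u v, G.Adj u v ∧ s = {u, v}}

/-- `G` contains exactly one cycle: some closed walk of `G` is a cycle, and all
cycles of `G` have the same edge set. -/
def ExactlyOneCycle {V : Type*} [DecidableEq V] (G : SimpleGraph V) : Prop :=
  (∃ (u : V) (w : G.Walk u u), w.IsCycle) ∧
    ∀ (u v : V) (w : G.Walk u u) (w' : G.Walk v v), w.IsCycle → w'.IsCycle →
      w.edges.toFinset = w'.edges.toFinset

section Hypergraph

variable {α : Type*} [DecidableEq α]

lemma mem_lcmU {σ : Finset (Finset α)} {x : α} : x ∈ lcmU σ ↔ ∃ e ∈ σ, x ∈ e := by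
  simp [lcmU, Finset.mem_sup]

lemma isBridge_iff_forall_exists {σ : Finset (Finset α)} {m : Finset α} :
    IsBridge σ m ↔ m ∈ σ ∧ ∀ x ∈ m, ∃ e ∈ σ, e ≠ m ∧ x ∈ e := by
  refine and_congr_right fun hm => ?_
  simp only [Finset.ext_iff, mem_lcmU, Finset.mem_erase]
  refine ⟨fun h x hx => ?_, fun h x => ?_⟩
  · obtain ⟨e, he, hxe⟩ := (h x).2 ⟨m, hm, hx⟩
    exact ⟨e, he.2, he.1, hxe⟩
  · grind

lemma isGap_iff_forall_exists {M : Set (Finset α)} {σ : Finset (Finset α)} {m : Finset α} :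
    IsGap M σ m ↔ m ∈ M ∧ m ∉ σ ∧ ∀ x ∈ m, ∃ e ∈ σ, x ∈ e := by
  refine and_congr_right fun _ => and_congr_right fun hm => ?_
  rw [Finset.ext_iff]
  simp only [mem_lcmU, Finset.mem_insert]
  refine ⟨fun h x hx => (h x).1 ⟨m, Or.inl rfl, hx⟩, fun h x => ?_⟩
  grind

lemma PotType2.not_isTrueGap_of_isSBridge {M : Set (Finset α)} {ord : Finset α → ℕ}
    {σ : Finset (Finset α)} {b g : Finset α} (h : PotType2 M ord σ) (hb : IsSBridge ord σ b)
    (hg : ord g < ord b) : ¬ IsTrueGap M ord σ g := by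
  obtain ⟨m, hm, hm'⟩ := h
  exact fun hg' => hm' g hg' (hg.trans_le (hb.2 m hm))

/-- A gap below the smallest bridge of a potentially-type-2 set creates a smaller new bridge. -/
lemma PotType2.exists_new_bridge {M : Set (Finset α)} {ord : Finset α → ℕ}
    {σ : Finset (Finset α)} {b g : Finset α} (h : PotType2 M ord σ) (hb : IsSBridge ord σ b)
    (hg : IsGap M σ g) (hgb : ord g < ord b) :
    ∃ m ∈ σ, ord m < ord g ∧ IsBridge (insert g σ) m ∧
      ∃ x ∈ m, x ∈ g ∧ ∀ e ∈ σ, e ≠ m → x ∉ e := by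
  have := h.not_isTrueGap_of_isSBridge hb hgb
  simp only [IsTrueGap, not_and, not_forall] at this
  obtain ⟨m, hm, hmg, hmσ⟩ := this hg
  have hm' := hm
  rw [isBridge_iff_forall_exists] at hm hmσ
  refine ⟨m, ?_, hmg, hm', ?_⟩ <;> grind

/-- Two potentially-type-2 sets that agree after removal of their smallest bridges share an
element, smaller than both bridges, that joins the two bridges. -/
lemma exists_middle_of_erase_eq {M : Set (Finset α)} {ord : Finset α → ℕ}
    {σ σ' : Finset (Finset α)} {b b' : Finset α} (hσ : ↑σ ⊆ M)
    (h' : PotType2 M ord σ') (hb : IsSBridge ord σ b) (hb' : IsSBridge ord σ' b')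
    (he : σ'.erase b' = σ.erase b) (hlt : ord b < ord b') :
    ∃ m ∈ σ.erase b, ord m < ord b ∧ ∃ x ∈ m, ∃ y ∈ m, x ∈ b ∧ x ∉ b' ∧ y ∈ b' ∧ y ∉ b := by
  have hbσ := isBridge_iff_forall_exists.1 hb.1
  have hmem : ∀ e, e ∈ σ'.erase b' ↔ e ∈ σ.erase b := fun e => by rw [he]
  simp only [Finset.mem_erase] at hmem
  have hne : b ≠ b' := by rintro rfl; exact lt_irrefl _ hlt
  have hgap : IsGap M σ' b := isGap_iff_forall_exists.2
    ⟨hσ hbσ.1, fun h => (hmem b).1 ⟨hne, h⟩ |>.1 rfl, fun x hx => by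
      obtain ⟨e, h1, h2, h3⟩ := hbσ.2 x hx
      exact ⟨e, ((hmem e).2 ⟨h2, h1⟩).2, h3⟩⟩
  obtain ⟨m, hmσ', hmb, hm, x, hxm, hxb, hx⟩ := h'.exists_new_bridge hb' hgap hlt
  have hmb' : m ≠ b' := by rintro rfl; omega
  have hmτ := (hmem m).1 ⟨hmb', hmσ'⟩
  have hmσ : ¬ IsBridge σ m := fun h => absurd (hb.2 m h) (by omega)
  rw [isBridge_iff_forall_exists] at hm hmσ
  simp only [hmτ.2, true_and, not_forall] at hmσ
  obtain ⟨y, hym, hy⟩ := hmσ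
  push Not at hy
  have hb'σ' := hb'.1.1
  obtain ⟨e, he1, he2, he3⟩ := hm.2 y hym
  refine ⟨m, Finset.mem_erase.2 hmτ, hmb, x, hxm, y, hym, hxb, hx _ hb'σ' hmb'.symm, ?_, ?_⟩
  · have : e = b' := by
      by_contra hne'
      rcases Finset.mem_insert.1 he1 with rfl | he1
      · exact hy _ hbσ.1 he2 he3
      · exact hy e ((hmem e).1 ⟨hne', he1⟩).2 he2 he3
    exact this ▸ he3
  · exact hy b hbσ.1 hmτ.1.symm

end Hypergraph

section Graph

variable {V : Type*} [DecidableEq V] {G : SimpleGraph V}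

lemma pair_mem_edgeSets {u v : V} (h : G.Adj u v) : ({u, v} : Finset V) ∈ edgeSets G :=
  ⟨u, v, h, rfl⟩

lemma exists_eq_pair_of_mem_edgeSets {e : Finset V} {x : V} (he : e ∈ edgeSets G) (hx : x ∈ e) :
    ∃ p, G.Adj x p ∧ e = {x, p} := by
  obtain ⟨u, v, h, rfl⟩ := he
  rcases Finset.mem_insert.1 hx with rfl | hx
  · exact ⟨v, h, rfl⟩
  · rw [Finset.mem_singleton] at hx
    subst hx
    exact ⟨u, h.symm, Finset.pair_comm _ _⟩

/-- On a five-cycle `p x y q r` whose vertex `p` has no neighbours besides `x` and `r`, the edge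
`yq` is not the smallest bridge of a potentially-type-2 set covering `p` without `px`, provided
`qr` is smaller than `yq` and `pr`. -/
lemma PotType2.false_of_isSBridge_pair {ord : Finset V → ℕ} {σ : Finset (Finset V)}
    {p x y q r : V} (hσ : ↑σ ⊆ edgeSets G) (h : PotType2 (edgeSets G) ord σ)
    (hs : IsSBridge ord σ {y, q}) (hp : ∃ e ∈ σ, p ∈ e) (hpx : {p, x} ∉ σ)
    (hnbr : ∀ z, G.Adj p z → z = x ∨ z = r) (hqr : G.Adj q r)
    (hpq : p ≠ q) (hyr : y ≠ r) (hlt : ord {q, r} < ord {y, q})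
    (hlt' : ord {q, r} < ord {p, r}) : False := by
  obtain ⟨e, heσ, hpe⟩ := hp
  obtain ⟨z, hz, rfl⟩ := exists_eq_pair_of_mem_edgeSets (hσ heσ) hpe
  obtain rfl : z = r := (hnbr z hz).resolve_left fun h => hpx (h ▸ heσ)
  have hyq := hs.1.1
  by_cases hqz : ({q, z} : Finset V) ∈ σ
  · refine absurd (hs.2 {q, z} (isBridge_iff_forall_exists.2 ⟨hqz, fun w hw => ?_⟩)) (by omega)
    rcases Finset.mem_insert.1 hw with rfl | hw
    · exact ⟨_, hyq, fun h => by rw [h] at hlt; omega, by simp⟩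
    · rw [Finset.mem_singleton] at hw
      subst hw
      exact ⟨_, heσ, fun h => by rw [h] at hlt'; omega, by simp⟩
  · have hgap : IsGap (edgeSets G) σ {q, z} := isGap_iff_forall_exists.2
      ⟨pair_mem_edgeSets hqr, hqz, fun w hw => by
        rcases Finset.mem_insert.1 hw with rfl | hw
        · exact ⟨_, hyq, by simp⟩
        · exact ⟨_, heσ, by simp [Finset.mem_singleton.1 hw]⟩⟩
    obtain ⟨m, -, hm, -, w, -, hwg, hw⟩ := h.exists_new_bridge hs hgap hlt
    rcases Finset.mem_insert.1 hwg with rfl | hwg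
    · exact hw _ hyq (by rintro rfl; omega) (by simp)
    · exact hw _ heσ (by rintro rfl; omega) (by simp [Finset.mem_singleton.1 hwg])

/-- A combinatorial criterion for bridge-friendliness of edge ideals: it is enough that middle
edges of paths are minimal only in two special positions on a five-cycle. -/
lemma bridgeFriendly_of_order {v₀ v₁ v₂ v₃ v₄ : V} {ord : Finset V → ℕ}
    (hinj : Set.InjOn ord (edgeSets G))
    (h02 : v₀ ≠ v₂) (h03 : v₀ ≠ v₃) (h24 : v₂ ≠ v₄) (h13 : v₁ ≠ v₃)
    (h12 : G.Adj v₁ v₂) (h34 : G.Adj v₃ v₄)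
    (hnbr : ∀ z, G.Adj v₀ z → z = v₁ ∨ z = v₄)
    (hl1 : ord {v₁, v₂} < ord {v₂, v₃}) (hl2 : ord {v₁, v₂} < ord {v₀, v₁})
    (hl3 : ord {v₃, v₄} < ord {v₂, v₃}) (hl4 : ord {v₃, v₄} < ord {v₀, v₄})
    (hmid : ∀ a b c d, G.Adj a b → G.Adj b c → G.Adj c d → a ≠ c → b ≠ d →
      ord {b, c} < ord {a, b} → ord {b, c} < ord {c, d} →
      (a = v₀ ∧ b = v₁ ∧ c = v₂ ∧ d = v₃) ∨ (a = v₃ ∧ b = v₂ ∧ c = v₁ ∧ d = v₀) ∨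
      (a = v₀ ∧ b = v₄ ∧ c = v₃ ∧ d = v₂) ∨ (a = v₂ ∧ b = v₃ ∧ c = v₄ ∧ d = v₀)) :
    BridgeFriendly (edgeSets G) := by
  refine ⟨ord, hinj, fun σ hσ h => ⟨h, fun σ' hσ' hne h' b b' hb hb' he => ?_⟩⟩
  by_contra! hle
  have hbne : b ≠ b' := by
    rintro rfl
    exact hne (by rw [← Finset.insert_erase hb'.1.1, he, Finset.insert_erase hb.1.1])
  have hlt : ord b' < ord b :=
    hle.lt_of_ne fun h => hbne (hinj (hσ hb.1.1) (hσ' hb'.1.1) h.symm)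
  obtain ⟨m, hm, hmb, x, hxm, y, hym, hxb, hxb', hyb, hyb'⟩ :=
    exists_middle_of_erase_eq hσ' h hb' hb he.symm hlt
  obtain ⟨y', hxy, rfl⟩ := exists_eq_pair_of_mem_edgeSets (hσ' (Finset.mem_of_mem_erase hm)) hxm
  obtain rfl : y = y' := by
    rcases Finset.mem_insert.1 hym with rfl | hym
    · exact absurd hyb hxb'
    · exact Finset.mem_singleton.1 hym
  obtain ⟨p, hxp, rfl⟩ := exists_eq_pair_of_mem_edgeSets (hσ' hb'.1.1) hxb
  obtain ⟨q, hyq, rfl⟩ := exists_eq_pair_of_mem_edgeSets (hσ hb.1.1) hyb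
  rw [Finset.pair_comm x p] at *
  have hbσ := isBridge_iff_forall_exists.1 hb.1
  have hbσ' := isBridge_iff_forall_exists.1 hb'.1
  have hmem : ∀ e, e ∈ σ'.erase {p, x} ↔ e ∈ σ.erase {y, q} := fun e => by rw [he]
  simp only [Finset.mem_erase] at hmem
  have hpxσ : {p, x} ∉ σ := fun h => ((hmem _).2 ⟨hbne.symm, h⟩).1 rfl
  have hyqσ' : {y, q} ∉ σ' := fun h => ((hmem _).1 ⟨hbne, h⟩).1 rfl
  have hp : ∃ e ∈ σ, p ∈ e := by
    obtain ⟨e, h1, h2, h3⟩ := hbσ'.2 p (by simp)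
    exact ⟨e, ((hmem e).1 ⟨h2, h1⟩).2, h3⟩
  have hq : ∃ e ∈ σ', q ∈ e := by
    obtain ⟨e, h1, h2, h3⟩ := hbσ.2 q (by simp)
    exact ⟨e, ((hmem e).2 ⟨h2, h1⟩).2, h3⟩
  rcases hmid p x y q hxp.symm hxy hyq (by rintro rfl; simp at hyb')
      (by rintro rfl; simp at hxb') hmb (hmb.trans hlt) with
    ⟨rfl, rfl, rfl, rfl⟩ | ⟨rfl, rfl, rfl, rfl⟩ | ⟨rfl, rfl, rfl, rfl⟩ | ⟨rfl, rfl, rfl, rfl⟩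
  · exact h.false_of_isSBridge_pair hσ hb hp hpxσ hnbr h34 h03 h24 hl3 hl4
  · rw [Finset.pair_comm p x] at hb'
    rw [Finset.pair_comm y q] at hyqσ'
    exact h'.false_of_isSBridge_pair hσ' hb' hq hyqσ' hnbr h34 h03 h24 hl3 hl4
  · rw [Finset.pair_comm q y, Finset.pair_comm v₁ q] at hl1
    rw [Finset.pair_comm v₁ q] at hl2
    exact h.false_of_isSBridge_pair hσ hb hp hpxσ (fun z hz => (hnbr z hz).symm) h12.symm h02
      h13.symm hl1 hl2
  · rw [Finset.pair_comm v₁ p] at hl1 hl2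
    rw [Finset.pair_comm y q] at hyqσ'
    exact h'.false_of_isSBridge_pair hσ' (Finset.pair_comm p x ▸ hb') hq hyqσ'
      (fun z hz => (hnbr z hz).symm) h12.symm h02 h13.symm
      (Finset.pair_comm p x ▸ hl1) hl2

end Graph

section Walks

variable {V : Type*} {G : SimpleGraph V}

/-- Each vertex of a rooted tree has at most one parent. -/
lemma SimpleGraph.IsTree.eq_of_dist_eq_dist_add_one {T : SimpleGraph V} (hT : T.IsTree)
    {r u a b : V} (ha : T.Adj u a) (hb : T.Adj u b) (hda : T.dist r u = T.dist r a + 1)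
    (hdb : T.dist r u = T.dist r b + 1) : a = b := by
  obtain ⟨p, hp⟩ := hT.connected.exists_walk_length_eq_dist r a
  obtain ⟨q, hq⟩ := hT.connected.exists_walk_length_eq_dist r b
  have hp' := (p.concat ha.symm).isPath_of_length_eq_dist (by rw [Walk.length_concat, hp, hda])
  have hq' := (q.concat hb.symm).isPath_of_length_eq_dist (by rw [Walk.length_concat, hq, hdb])
  have h : p.concat ha.symm = q.concat hb.symm :=
    congrArg Subtype.val ((hT.isAcyclic.subsingleton_path r u).elim ⟨_, hp'⟩ ⟨_, hq'⟩)
  exact (Walk.concat_inj h).1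

lemma SimpleGraph.Walk.IsCycle.exists_five_vertices {v : V} {w : G.Walk v v} (hw : w.IsCycle)
    (hlen : w.length = 5) : ∃ v₁ v₂ v₃ v₄ : V, [v, v₁, v₂, v₃, v₄].Nodup ∧
      G.Adj v v₁ ∧ G.Adj v₁ v₂ ∧ G.Adj v₂ v₃ ∧ G.Adj v₃ v₄ ∧ G.Adj v₄ v ∧ s(v, v₁) ∈ w.edges := by
  match w, hlen with
  | .cons (v := v₁) h₁ (.cons (v := v₂) h₂ (.cons (v := v₃) h₃ (.cons (v := v₄) h₄
      (.cons h₅ .nil)))), _ =>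
    have hn := hw.support_nodup
    simp only [Walk.support_cons, Walk.support_nil, List.tail_cons] at hn
    exact ⟨v₁, v₂, v₃, v₄, (List.perm_append_comm (l₁ := [v])).nodup_iff.2 hn,
      h₁, h₂, h₃, h₄, h₅, by simp⟩

end Walks

section Order

variable {V : Type*} [DecidableEq V] {G : SimpleGraph V}

lemma finset_pair_eq_pair_iff {a b c d : V} :
    ({a, b} : Finset V) = {c, d} ↔ a = c ∧ b = d ∨ a = d ∧ b = c := by
  rw [← Finset.coe_inj]
  simp [Set.pair_eq_pair_iff]

/-- In a connected graph whose cycles all have the same edges, deleting an edge of a cycle leaves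
a tree. -/
lemma isTree_deleteEdges_of_isCycle (hconn : G.Connected) (huni : ExactlyOneCycle G) {u a b : V}
    {w : G.Walk u u} (hw : w.IsCycle) (hab : s(a, b) ∈ w.edges) :
    (G.deleteEdges {s(a, b)}).IsTree := by
  refine ⟨hconn.connected_delete_edge_of_not_isBridge fun h => h.notMem_edges_of_isCycle hw hab,
    fun v c hc => ?_⟩
  have h := huni.2 u v w _ hw (hc.mapLe (G.deleteEdges_le {s(a, b)}))
  have hmem : s(a, b) ∈ c.edges := by
    rw [← List.mem_toFinset, h] at hab
    simpa using hab
  simpa using c.edges_subset_edgeSet hmem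

/-- A ranking of the edges of a unicyclic graph with cycle `v₀ v₁ v₂ v₃ v₄`: edges outside the
cycle come first, ordered by decreasing depth, then `v₁v₂` and `v₃v₄`, then the rest. -/
def edgeRank (v₀ v₁ v₂ v₃ v₄ : V) (d : V → ℕ) (K : ℕ) (e : Finset V) : ℕ :=
  if e = {v₁, v₂} ∨ e = {v₃, v₄} then K + 1
  else if e = {v₀, v₁} ∨ e = {v₂, v₃} ∨ e = {v₀, v₄} then K + 2
  else K - e.sup d

lemma middle_of_edgeRank_le {v₀ v₁ v₂ v₃ v₄ : V} {d : V → ℕ} {K : ℕ}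
    (hv : [v₀, v₁, v₂, v₃, v₄].Nodup) (h12 : G.Adj v₁ v₂) (h23 : G.Adj v₂ v₃)
    (h34 : G.Adj v₃ v₄) (h40 : G.Adj v₄ v₀) (hK : ∀ v, d v ≤ K) (h0 : d v₀ = 0)
    (hstep : ∀ u v, G.Adj u v → s(u, v) ≠ s(v₀, v₁) → d u = d v + 1 ∨ d v = d u + 1)
    (huniq : ∀ u a b, G.Adj u a → G.Adj u b → s(u, a) ≠ s(v₀, v₁) → s(u, b) ≠ s(v₀, v₁) →
      d u = d a + 1 → d u = d b + 1 → a = b)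
    {a b c e : V} (hab : G.Adj a b) (hbc : G.Adj b c) (hce : G.Adj c e) (hac : a ≠ c) (hbe : b ≠ e)
    (hle : edgeRank v₀ v₁ v₂ v₃ v₄ d K {b, c} ≤ edgeRank v₀ v₁ v₂ v₃ v₄ d K {a, b})
    (hle' : edgeRank v₀ v₁ v₂ v₃ v₄ d K {b, c} ≤ edgeRank v₀ v₁ v₂ v₃ v₄ d K {c, e}) :
    (a = v₀ ∧ b = v₁ ∧ c = v₂ ∧ e = v₃) ∨ (a = v₃ ∧ b = v₂ ∧ c = v₁ ∧ e = v₀) ∨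
      (a = v₀ ∧ b = v₄ ∧ c = v₃ ∧ e = v₂) ∨ (a = v₂ ∧ b = v₃ ∧ c = v₄ ∧ e = v₀) := by
  simp only [List.nodup_cons, List.mem_cons, not_or, List.not_mem_nil, not_false_eq_true,
    List.nodup_nil, and_true] at hv
  simp only [ne_eq, Sym2.eq_iff] at hstep huniq
  have hchild : ∀ u a c, G.Adj u a → G.Adj u c → ¬(u = v₀ ∧ a = v₁ ∨ u = v₁ ∧ a = v₀) →
      ¬(u = v₀ ∧ c = v₁ ∨ u = v₁ ∧ c = v₀) → a ≠ c → d u = d c + 1 → d a = d u + 1 :=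
    fun u a c ha hc ha' hc' hac hd => (hstep u a ha ha').resolve_left fun h =>
      hac (huniq u a c ha hc ha' hc' h hd)
  have hd4 : d v₄ = 1 := by
    have := hstep v₄ v₀ h40 (by grind)
    omega
  have hd3 : d v₃ = 2 := by
    have := hchild v₄ v₃ v₀ h34.symm h40 (by grind) (by grind) (by grind) (by omega)
    omega
  have hd2 : d v₂ = 3 := by
    have := hchild v₃ v₂ v₄ h23.symm h34 (by grind) (by grind) (by grind) (by omega)
    omega
  have hd1 : d v₁ = 4 := by
    have := hchild v₂ v₁ v₃ h12.symm h23 (by grind) (by grind) (by grind) (by omega)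
    omega
  have hrank : ∀ u v, edgeRank v₀ v₁ v₂ v₃ v₄ d K {u, v} =
      if (u = v₁ ∧ v = v₂ ∨ u = v₂ ∧ v = v₁) ∨ u = v₃ ∧ v = v₄ ∨ u = v₄ ∧ v = v₃ then K + 1
      else if (u = v₀ ∧ v = v₁ ∨ u = v₁ ∧ v = v₀) ∨ (u = v₂ ∧ v = v₃ ∨ u = v₃ ∧ v = v₂) ∨
        u = v₀ ∧ v = v₄ ∨ u = v₄ ∧ v = v₀ then K + 2
      else K - max (d u) (d v) := fun u v => by
    simp [edgeRank, finset_pair_eq_pair_iff]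
  have hlower : ∀ a b c, G.Adj a b → G.Adj b c → a ≠ c → d b = d c + 1 →
      edgeRank v₀ v₁ v₂ v₃ v₄ d K {b, c} ≤ K →
      edgeRank v₀ v₁ v₂ v₃ v₄ d K {a, b} < edgeRank v₀ v₁ v₂ v₃ v₄ d K {b, c} := by
    intro a b c hab hbc hac hd hle
    have hp : b ≠ v₀ ∧ b ≠ v₁ ∧ b ≠ v₂ ∧ b ≠ v₃ ∧ b ≠ v₄ := by
      rw [hrank] at hle
      refine ⟨?_, ?_, ?_, ?_, ?_⟩ <;> rintro rfl
      · omega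
      · have := huniq b c v₂ hbc h12 (by grind) (by grind) hd (by omega)
        grind
      · have := huniq b c v₃ hbc h23 (by grind) (by grind) hd (by omega)
        grind
      · have := huniq b c v₄ hbc h34 (by grind) (by grind) hd (by omega)
        grind
      · have := huniq b c v₀ hbc h40 (by grind) (by grind) hd (by omega)
        grind
    have hda := hchild b a c hab.symm hbc (by grind) (by grind) hac hd
    have hKa := hK a
    rw [hrank, hrank, if_neg (by grind), if_neg (by grind), if_neg (by grind), if_neg (by grind)]
    omega
  by_cases hbcK : edgeRank v₀ v₁ v₂ v₃ v₄ d K {b, c} ≤ K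
  · rcases hstep b c hbc (by rw [hrank] at hbcK; grind) with hd | hd
    · exact absurd (hlower a b c hab hbc hac hd hbcK) (by omega)
    · rw [Finset.pair_comm b c] at hbcK hle'
      rw [Finset.pair_comm c e] at hle'
      exact absurd (hlower e c b hce.symm hbc.symm hbe.symm hd hbcK) (by omega)
  · rw [hrank] at hle hle' hbcK
    rw [hrank] at hle hle'
    clear hlower hchild hrank huniq hstep
    have hb : b = v₀ ∨ b = v₁ ∨ b = v₂ ∨ b = v₃ ∨ b = v₄ := by grind
    have hc : c = v₀ ∨ c = v₁ ∨ c = v₂ ∨ c = v₃ ∨ c = v₄ := by grind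
    rcases hb with rfl | rfl | rfl | rfl | rfl <;> rcases hc with rfl | rfl | rfl | rfl | rfl <;>
      grind

end Order

/-- If `G` is a finite connected unicyclic graph whose unique cycle is a `C₅`
containing a vertex of degree `2` in `G`, then the edge ideal `I(G)` is
bridge-friendly. -/
theorem bridgeFriendly_of_C5 {V : Type*} [Fintype V] [DecidableEq V]
    (G : SimpleGraph V) [DecidableRel G.Adj]
    (hconn : G.Connected) (huni : ExactlyOneCycle G)
    (hC5 : ∃ (u : V) (w : G.Walk u u), w.IsCycle ∧ w.length = 5 ∧
      ∃ v ∈ w.support, G.degree v = 2) :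
    BridgeFriendly (edgeSets G) := by
  obtain ⟨u, w, hw, hlen, v₀, hv₀, hdeg⟩ := hC5
  have hw' := hw.rotate hv₀
  obtain ⟨v₁, v₂, v₃, v₄, hv, h01, h12, h23, h34, h40, he⟩ :=
    hw'.exists_five_vertices (by rw [SimpleGraph.Walk.length_rotate, hlen])
  have hT := isTree_deleteEdges_of_isCycle hconn huni hw' he
  set T := G.deleteEdges {s(v₀, v₁)} with hTdef
  have hTadj : ∀ u v, G.Adj u v → s(u, v) ≠ s(v₀, v₁) → T.Adj u v := fun u v h h' => by
    simp [hTdef, h, -Sym2.eq, h']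
  have hnbr : ∀ z, G.Adj v₀ z → z = v₁ ∨ z = v₄ := by
    have hsub : ({v₁, v₄} : Finset V) ⊆ G.neighborFinset v₀ := by
      simp [Finset.insert_subset_iff, h01, h40.symm]
    have heq := Finset.eq_of_subset_of_card_le hsub (by
      rw [G.card_neighborFinset_eq_degree, hdeg, Finset.card_pair (by grind)])
    intro z hz
    simpa [← heq] using (G.mem_neighborFinset v₀ z).2 hz
  let d := T.dist v₀
  let K := Finset.univ.sup d
  let rank := edgeRank v₀ v₁ v₂ v₃ v₄ d K
  let N := Fintype.card (Finset V)
  let idx := Fintype.equivFin (Finset V)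
  let ord : Finset V → ℕ := fun e => idx e + N * rank e
  have hidx : ∀ e, (idx e : ℕ) < N := fun e => (idx e).2
  have hlt : ∀ e f, rank e < rank f → ord e < ord f := fun e f h => by
    have := Nat.mul_le_mul_left N (Nat.succ_le_of_lt h)
    have := hidx e
    simp only [ord]
    linarith [Nat.mul_succ N (rank e)]
  have hle : ∀ e f, ord e < ord f → rank e ≤ rank f := fun e f h =>
    not_lt.1 fun h' => lt_asymm h (hlt f e h')
  have hinj : Function.Injective ord := fun e f h => by
    have hr : rank e = rank f := le_antisymm
      (not_lt.1 fun h' => (hlt f e h').ne' h) (not_lt.1 fun h' => (hlt e f h').ne h)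
    simp only [ord, hr, add_left_inj] at h
    exact idx.injective (Fin.ext h)
  refine bridgeFriendly_of_order (v₀ := v₀) (v₁ := v₁) (v₂ := v₂) (v₃ := v₃) (v₄ := v₄)
    hinj.injOn (by grind) (by grind) (by grind) (by grind) h12 h34 hnbr
    (hlt _ _ ?_) (hlt _ _ ?_) (hlt _ _ ?_) (hlt _ _ ?_)
    fun a b c e hab hbc hce hac hbe h h' => middle_of_edgeRank_le hv h12 h23 h34 h40
      (fun v => Finset.le_sup (Finset.mem_univ v)) SimpleGraph.dist_self
      (fun u v h h' => hT.dist_eq_dist_add_one_of_adj v₀ (hTadj u v h h'))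
      (fun u a b ha hb ha' hb' => hT.eq_of_dist_eq_dist_add_one (hTadj u a ha ha')
        (hTadj u b hb hb')) hab hbc hce hac hbe (hle _ _ h) (hle _ _ h')
  all_goals
    simp only [rank, edgeRank, finset_pair_eq_pair_iff]
    grind
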